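/- A hitting CNF formula F is unsatisfiable if and only if Σ_{C ∈ F} 2^{-|C|} = 1. -/

import Mathlib

/-- A literal: a variable (natural number) with a polarity. -/
abbrev Lit : Type := ℕ × Bool

/-- Negation of a literal. -/
def Lit.neg (ℓ : Lit) : Lit := (ℓ.1, !ℓ.2)

/-- A clause: a finite set of literals. -/
abbrev Clause : Type := Finset Lit

/-- A clause is non-tautological: it contains no literal together with its negation. -/
def Clause.NonTaut (C : Clause) : Prop := ∀ ℓ ∈ C, Lit.neg ℓ ∉ C

/-- A CNF formula: a finite set of clauses. -/
abbrev CNF : Type := Finset Clause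

/-- A CNF formula is well-formed if all of its clauses are non-tautological. -/
def CNF.WellFormed (F : CNF) : Prop := ∀ C ∈ F, C.NonTaut

/-- A (total) assignment `τ` satisfies a literal. -/
def SatLit (τ : ℕ → Bool) (ℓ : Lit) : Prop := τ ℓ.1 = ℓ.2

/-- An assignment satisfies a clause if it satisfies some literal of it. -/
def SatClause (τ : ℕ → Bool) (C : Clause) : Prop := ∃ ℓ ∈ C, SatLit τ ℓ

/-- An assignment satisfies a CNF formula if it satisfies all of its clauses. -/
def SatCNF (τ : ℕ → Bool) (F : CNF) : Prop := ∀ C ∈ F, SatClause τ C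

/-- A CNF formula is unsatisfiable if no assignment satisfies it. -/
def Unsat (F : CNF) : Prop := ¬ ∃ τ : ℕ → Bool, SatCNF τ F

/-- `F` entails `G`: every model of `F` is a model of `G`. -/
def Entails (F G : CNF) : Prop := ∀ τ : ℕ → Bool, SatCNF τ F → SatCNF τ G

/-- Logical equivalence of CNF formulas. -/
def Equivalent (F G : CNF) : Prop := Entails F G ∧ Entails G F

/-- Two clauses clash: one contains a literal whose negation is in the other. -/
def Clash (C D : Clause) : Prop := ∃ ℓ ∈ C, Lit.neg ℓ ∈ D

/-- A formula is hitting if every pair of distinct clauses clashes. -/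
def Hitting (F : CNF) : Prop := ∀ C ∈ F, ∀ D ∈ F, C ≠ D → Clash C D

/-- The set of variables occurring in a CNF formula. -/
def cnfVars (F : CNF) : Finset ℕ := F.sup fun C => C.image Prod.fst

/-- The assignments of the variables in `V` that falsify every literal of `C` over `V`. -/
def falsifying (V : Finset ℕ) (C : Clause) : Finset (V → Bool) :=
  Fintype.piFinset fun v => Finset.univ.filter fun b => ((v : ℕ), b) ∉ C

lemma mem_falsifying {V : Finset ℕ} {C : Clause} {σ : V → Bool} :
    σ ∈ falsifying V C ↔ ∀ v : V, ((v : ℕ), σ v) ∉ C := by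
  simp [falsifying]

lemma Clause.NonTaut.card_filter_mul {C : Clause} (hC : C.NonTaut) (v : ℕ) :
    (Finset.univ.filter fun b => (v, b) ∉ C).card * 2 ^ (C.filter fun ℓ => ℓ.1 = v).card = 2 := by
  have hfiber : (C.filter fun ℓ => ℓ.1 = v).card =
      (Finset.univ.filter fun b => (v, b) ∈ C).card := by
    symm
    refine Finset.card_bij (fun b _ => (v, b)) (by simp) (by simp) ?_
    rintro ⟨w, b⟩ h
    obtain ⟨h, rfl⟩ := Finset.mem_filter.mp h
    exact ⟨b, by simpa using h, rfl⟩
  have hfalse := hC (v, false)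
  have htrue := hC (v, true)
  rw [hfiber]
  by_cases h₁ : (v, true) ∈ C <;> by_cases h₂ : (v, false) ∈ C <;>
    simp_all [Lit.neg, Finset.filter_insert, Finset.filter_singleton]

lemma card_falsifying_mul {V : Finset ℕ} {C : Clause} (hC : C.NonTaut)
    (hV : ∀ ℓ ∈ C, ℓ.1 ∈ V) : (falsifying V C).card * 2 ^ C.card = 2 ^ V.card := by
  rw [Finset.card_eq_sum_card_fiberwise (f := Prod.fst) (t := V) hV,
    ← Finset.prod_pow_eq_pow_sum, ← Finset.prod_coe_sort, falsifying, Fintype.card_piFinset,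
    ← Finset.prod_mul_distrib, Finset.prod_congr rfl fun (v : V) _ => hC.card_filter_mul v]
  simp

lemma Clash.disjoint_falsifying {V : Finset ℕ} {C D : Clause} (h : Clash C D)
    (hV : ∀ ℓ ∈ C, ℓ.1 ∈ V) : Disjoint (falsifying V C) (falsifying V D) := by
  rw [Finset.disjoint_left]
  rintro σ hσC hσD
  obtain ⟨⟨v, b⟩, hC, hD⟩ := h
  have h₁ := mem_falsifying.mp hσC ⟨v, hV _ hC⟩
  have h₂ := mem_falsifying.mp hσD ⟨v, hV _ hC⟩
  cases hσ : σ ⟨v, hV _ hC⟩ <;> cases b <;> simp_all [Lit.neg]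

lemma not_satClause_iff {V : Finset ℕ} {C : Clause} (hV : ∀ ℓ ∈ C, ℓ.1 ∈ V) (τ : ℕ → Bool) :
    ¬ SatClause τ C ↔ (fun v : V => τ v) ∈ falsifying V C := by
  rw [mem_falsifying]
  constructor
  · exact fun h v hv => h ⟨_, hv, rfl⟩
  · rintro h ⟨⟨v, b⟩, hC, hτ⟩
    obtain rfl : τ v = b := hτ
    exact h ⟨v, hV _ hC⟩ hC

lemma unsat_iff_biUnion_falsifying {V : Finset ℕ} {F : CNF}
    (hV : ∀ C ∈ F, ∀ ℓ ∈ C, ℓ.1 ∈ V) :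
    Unsat F ↔ F.biUnion (falsifying V) = Finset.univ := by
  have hunsat : Unsat F ↔ ∀ τ : ℕ → Bool, ∃ C ∈ F, ¬ SatClause τ C := by
    simp [Unsat, SatCNF]
  simp only [hunsat, Finset.eq_univ_iff_forall, Finset.mem_biUnion]
  constructor
  · intro h σ
    obtain ⟨C, hC, hτ⟩ := h fun v => if hv : v ∈ V then σ ⟨v, hv⟩ else false
    exact ⟨C, hC, by simpa using (not_satClause_iff (hV C hC) _).mp hτ⟩
  · intro h τ
    obtain ⟨C, hC, hτ⟩ := h fun v => τ v
    exact ⟨C, hC, (not_satClause_iff (hV C hC) τ).mpr hτ⟩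

lemma mem_cnfVars {F : CNF} {C : Clause} (hC : C ∈ F) {ℓ : Lit} (hℓ : ℓ ∈ C) :
    ℓ.1 ∈ cnfVars F :=
  Finset.mem_sup.mpr ⟨C, hC, Finset.mem_image_of_mem Prod.fst hℓ⟩

/-- a hitting CNF formula `F` is unsatisfiable
iff `∑_{C ∈ F} 2^{-|C|} = 1`. -/
theorem hitting_unsat_iff (F : CNF) (hwf : F.WellFormed) (hhit : Hitting F) :
    Unsat F ↔ ∑ C ∈ F, (2 : ℚ) ^ (-(C.card : ℤ)) = 1 := by
  have hV : ∀ C ∈ F, ∀ ℓ ∈ C, ℓ.1 ∈ cnfVars F := fun C hC ℓ hℓ => mem_cnfVars hC hℓ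
  have hweight : ∀ C ∈ F, (2 : ℚ) ^ (-(C.card : ℤ)) =
      ((falsifying (cnfVars F) C).card : ℚ) / 2 ^ (cnfVars F).card := by
    intro C hC
    have h : ((falsifying (cnfVars F) C).card : ℚ) * 2 ^ C.card = 2 ^ (cnfVars F).card := by
      exact_mod_cast card_falsifying_mul (hwf C hC) (hV C hC)
    rw [zpow_neg, zpow_natCast, eq_div_iff (by positivity), ← h]
    field_simp
  have hdisj : (F : Set Clause).PairwiseDisjoint (falsifying (cnfVars F)) :=
    fun C hC D hD hne => (hhit C hC D hD hne).disjoint_falsifying (hV C hC)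
  rw [unsat_iff_biUnion_falsifying hV, ← Finset.card_eq_iff_eq_univ, Finset.card_biUnion hdisj,
    Finset.sum_congr rfl hweight, ← Finset.sum_div, div_eq_one_iff_eq (by positivity)]
  simp only [Fintype.card_fun, Fintype.card_bool, Fintype.card_coe]
  norm_cast
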